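/- Forward/Backward Partition Correctness (two-stage grouping): Let N be an NFA with vertex type V, let L0 be a backward-admissible partition of V, and let L_b be a partition of V that refines L0 and is backward-stable; let ≈_b be the equivalence relation induced by L_b and let N̄ := N/≈_b be the corresponding grouped NFA. Let M be a partition of the vertices of N̄ such that the member of M containing the starting vertex of N̄ is a singleton, and such that M is forward-stable in N̄; let ≈_f be the equivalence relation induced by M. Then the grouped NFA N̄/≈_f has a conflict if and only if N has a conflict. -/

import Mathlib

/-- An NFA with accepting actions: vertices `V`, alphabet `A` (edge labels in
`Option A`, with `none` the ε-label), accepting actions `T` with a conflict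
relation, starting vertex, edge relation, and accepting-action assignment. -/
structure NFAA (V A T : Type*) where
  start : V
  edge : V → Option A → V → Prop
  conf : T → T → Prop
  act : V → Set T

variable {V A T : Type*}

/-- `w` is reachable from `v` on the sequence `τ`. -/
def NFAA.ReachFrom (N : NFAA V A T) : V → List (Option A) → V → Prop
  | v, [], w => v = w
  | v, σ :: τ, w => ∃ u : V, N.edge v σ u ∧ N.ReachFrom u τ w

/-- `w` is reachable (from the starting vertex) on the sequence `τ`. -/
def NFAA.Reach (N : NFAA V A T) (τ : List (Option A)) (w : V) : Prop :=
  N.ReachFrom N.start τ w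

/-- A conflict: two sequences with equal strings, reaching vertices carrying
conflicting actions. -/
def NFAA.HasConflict (N : NFAA V A T) : Prop :=
  ∃ τ τ' : List (Option A), ∃ w w' : V, ∃ a a' : T,
    τ.filterMap id = τ'.filterMap id ∧
    N.Reach τ w ∧ N.Reach τ' w' ∧
    a ∈ N.act w ∧ a' ∈ N.act w' ∧ N.conf a a'

/-- The grouped NFA `N/∼` for an equivalence relation (setoid) `s` on `V`. -/
def NFAA.group (N : NFAA V A T) (s : Setoid V) : NFAA (Quotient s) A T where
  start := Quotient.mk s N.start
  edge c σ d := ∃ v w : V, Quotient.mk s v = c ∧ Quotient.mk s w = d ∧ N.edge v σ w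
  conf := N.conf
  act c := {a : T | ∃ v : V, Quotient.mk s v = c ∧ a ∈ N.act v}

/-- Forward equivalence: reachable from the start on exactly the same sequences. -/
def NFAA.FwdEquiv (N : NFAA V A T) (v₁ v₂ : V) : Prop :=
  ∀ τ : List (Option A), N.Reach τ v₁ ↔ N.Reach τ v₂

/-- Backward equivalence with respect to an initial partition `L0`. -/
def NFAA.BwdEquiv (N : NFAA V A T) (L0 : Set (Set V)) (v₁ v₂ : V) : Prop :=
  ∀ Z ∈ L0, ∀ τ : List (Option A),
    (∃ w ∈ Z, N.ReachFrom v₁ τ w) ↔ (∃ w ∈ Z, N.ReachFrom v₂ τ w)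

/-- A partition of `V`: pairwise disjoint nonempty subsets whose union is `V`. -/
def IsPartitionOf (L : Set (Set V)) : Prop :=
  (∀ Z ∈ L, Z.Nonempty) ∧
  (∀ Z ∈ L, ∀ Z' ∈ L, Z ≠ Z' → Z ∩ Z' = ∅) ∧
  ⋃₀ L = Set.univ

/-- `L` refines `L0`: every member of `L` is contained in some member of `L0`. -/
def RefinesPartition (L L0 : Set (Set V)) : Prop :=
  ∀ Y ∈ L, ∃ Z ∈ L0, Y ⊆ Z

/-- The forward image `Z[σ]`. -/
def NFAA.fwdImg (N : NFAA V A T) (Z : Set V) (σ : Option A) : Set V :=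
  {w : V | ∃ z ∈ Z, N.edge z σ w}

/-- The backward image `Z⁻[σ]`. -/
def NFAA.bwdImg (N : NFAA V A T) (Z : Set V) (σ : Option A) : Set V :=
  {z : V | ∃ w ∈ Z, N.edge z σ w}

/-- `L` is forward-stable. -/
def NFAA.FwdStable (N : NFAA V A T) (L : Set (Set V)) : Prop :=
  ∀ Z ∈ L, ∀ σ : Option A, ∀ Y ∈ L,
    Y ⊆ N.fwdImg Z σ ∨ Y ∩ N.fwdImg Z σ = ∅

/-- `L` is backward-stable. -/
def NFAA.BwdStable (N : NFAA V A T) (L : Set (Set V)) : Prop :=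
  ∀ Z ∈ L, ∀ σ : Option A, ∀ Y ∈ L,
    Y ⊆ N.bwdImg Z σ ∨ Y ∩ N.bwdImg Z σ = ∅

/-- `L0` is backward-admissible. -/
def NFAA.BwdAdmissible (N : NFAA V A T) (L0 : Set (Set V)) : Prop :=
  ∀ Z ∈ L0, ∀ Z' ∈ L0,
    (∃ w₁ ∈ Z, ∃ w₂ ∈ Z', ∃ a ∈ N.act w₁, ∃ a' ∈ N.act w₂, N.conf a a') →
    ∀ v₁ ∈ Z, ∀ v₂ ∈ Z', ∃ a ∈ N.act v₁, ∃ a' ∈ N.act v₂, N.conf a a'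

/-- Membership in a common block of a forward-stable partition lifts edges at their targets. -/
theorem NFAA.FwdStable.exists_edge {N : NFAA V A T} {L : Set (Set V)} (h : N.FwdStable L)
    {s : Setoid V} (hs : ∀ v w : V, s.r v w ↔ ∃ Y ∈ L, v ∈ Y ∧ w ∈ Y)
    {x y y' : V} {σ : Option A} (he : N.edge x σ y) (hy : s.r y y') :
    ∃ x', s.r x x' ∧ N.edge x' σ y' := by
  obtain ⟨Z, hZ, hxZ, -⟩ := (hs x x).1 (s.refl x)
  obtain ⟨Y, hY, hyY, hyY'⟩ := (hs y y').1 hy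
  rcases h Z hZ σ Y hY with hsub | hdisj
  · obtain ⟨x', hx', he'⟩ := hsub hyY'
    exact ⟨x', (hs x x').2 ⟨Z, hZ, hxZ, hx'⟩, he'⟩
  · exact (Set.eq_empty_iff_forall_notMem.1 hdisj y ⟨hyY, x, hxZ, he⟩).elim

/-- Membership in a common block of a backward-stable partition lifts edges at their sources. -/
theorem NFAA.BwdStable.exists_edge {N : NFAA V A T} {L : Set (Set V)} (h : N.BwdStable L)
    {s : Setoid V} (hs : ∀ v w : V, s.r v w ↔ ∃ Y ∈ L, v ∈ Y ∧ w ∈ Y)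
    {x x' y : V} {σ : Option A} (he : N.edge x σ y) (hx : s.r x x') :
    ∃ y', s.r y y' ∧ N.edge x' σ y' := by
  obtain ⟨Z, hZ, hyZ, -⟩ := (hs y y).1 (s.refl y)
  obtain ⟨Y, hY, hxY, hxY'⟩ := (hs x x').1 hx
  rcases h Z hZ σ Y hY with hsub | hdisj
  · obtain ⟨y', hy', he'⟩ := hsub hxY'
    exact ⟨y', (hs y y').2 ⟨Z, hZ, hyZ, hy'⟩, he'⟩
  · exact (Set.eq_empty_iff_forall_notMem.1 hdisj x ⟨hxY, y, hyZ, he⟩).elim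

theorem NFAA.ReachFrom.group {N : NFAA V A T} (s : Setoid V) {τ : List (Option A)} {v w : V}
    (h : N.ReachFrom v τ w) :
    (N.group s).ReachFrom (Quotient.mk s v) τ (Quotient.mk s w) := by
  induction τ generalizing v with
  | nil => exact congrArg (Quotient.mk s) h
  | cons σ τ ih =>
    obtain ⟨u, he, hu⟩ := h
    exact ⟨Quotient.mk s u, ⟨v, u, rfl, rfl, he⟩, ih hu⟩

theorem NFAA.HasConflict.group {N : NFAA V A T} (s : Setoid V) (h : N.HasConflict) :
    (N.group s).HasConflict := by
  obtain ⟨τ, τ', w, w', a, a', hτ, hw, hw', ha, ha', hc⟩ := h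
  exact ⟨τ, τ', Quotient.mk s w, Quotient.mk s w', a, a', hτ, NFAA.ReachFrom.group s hw,
    NFAA.ReachFrom.group s hw', ⟨w, rfl, ha⟩, ⟨w', rfl, ha'⟩, hc⟩

/-- Under forward stability, every representative of a reachable class is reachable from some
representative of the source class. -/
theorem NFAA.FwdStable.exists_reachFrom {N : NFAA V A T} {L : Set (Set V)} (h : N.FwdStable L)
    {s : Setoid V} (hs : ∀ v w : V, s.r v w ↔ ∃ Y ∈ L, v ∈ Y ∧ w ∈ Y)
    {τ : List (Option A)} {c : Quotient s} {w : V}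
    (hr : (N.group s).ReachFrom c τ (Quotient.mk s w)) :
    ∃ v, Quotient.mk s v = c ∧ N.ReachFrom v τ w := by
  induction τ generalizing c with
  | nil => exact ⟨w, hr.symm, rfl⟩
  | cons σ τ ih =>
    obtain ⟨_, ⟨x, y, rfl, rfl, he⟩, hu⟩ := hr
    obtain ⟨y', hy', hr'⟩ := ih hu
    obtain ⟨x', hx', he'⟩ := h.exists_edge hs he (s.symm (Quotient.exact hy'))
    exact ⟨x', Quotient.sound (s.symm hx'), y', he', hr'⟩

/-- Under backward stability, every representative of the source class reaches some
representative of a reachable class. -/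
theorem NFAA.BwdStable.exists_reachFrom {N : NFAA V A T} {L : Set (Set V)} (h : N.BwdStable L)
    {s : Setoid V} (hs : ∀ v w : V, s.r v w ↔ ∃ Y ∈ L, v ∈ Y ∧ w ∈ Y)
    {τ : List (Option A)} {v : V} {d : Quotient s}
    (hr : (N.group s).ReachFrom (Quotient.mk s v) τ d) :
    ∃ w, Quotient.mk s w = d ∧ N.ReachFrom v τ w := by
  induction τ generalizing v with
  | nil => exact ⟨v, hr, rfl⟩
  | cons σ τ ih =>
    obtain ⟨_, ⟨x, y, hx, rfl, he⟩, hu⟩ := hr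
    obtain ⟨y', hy', he'⟩ := h.exists_edge hs he (Quotient.exact hx)
    rw [Quotient.sound hy'] at hu
    obtain ⟨w, hw, hr'⟩ := ih hu
    exact ⟨w, hw, y', he', hr'⟩

/-- Grouping by a forward-stable partition with a singleton starting block creates no conflict. -/
theorem NFAA.FwdStable.hasConflict_of_group {N : NFAA V A T} {L : Set (Set V)}
    (h : N.FwdStable L) {s : Setoid V}
    (hs : ∀ v w : V, s.r v w ↔ ∃ Y ∈ L, v ∈ Y ∧ w ∈ Y)
    (hstart : ∀ Z ∈ L, N.start ∈ Z → Z = {N.start}) (hc : (N.group s).HasConflict) :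
    N.HasConflict := by
  have reach {τ : List (Option A)} {w : V} (hr : (N.group s).Reach τ (Quotient.mk s w)) :
      N.Reach τ w := by
    obtain ⟨v, hv, hr'⟩ := h.exists_reachFrom hs hr
    obtain ⟨Z, hZ, hvZ, hsZ⟩ := (hs v N.start).1 (Quotient.exact hv)
    rw [hstart Z hZ hsZ, Set.mem_singleton_iff] at hvZ
    rwa [hvZ] at hr'
  obtain ⟨τ, τ', _, _, a, a', hτ, hw, hw', ⟨w, rfl, ha⟩, ⟨w', rfl, ha'⟩, hconf⟩ := hc
  exact ⟨τ, τ', w, w', a, a', hτ, reach hw, reach hw', ha, ha', hconf⟩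

/-- Grouping by a backward-stable refinement of a backward-admissible partition creates no
conflict. -/
theorem NFAA.BwdStable.hasConflict_of_group {N : NFAA V A T} {L0 L : Set (Set V)}
    (h : N.BwdStable L) (hadm : N.BwdAdmissible L0) (href : RefinesPartition L L0)
    {s : Setoid V} (hs : ∀ v w : V, s.r v w ↔ ∃ Y ∈ L, v ∈ Y ∧ w ∈ Y)
    (hc : (N.group s).HasConflict) : N.HasConflict := by
  have common_block {v w : V} (hvw : Quotient.mk s v = Quotient.mk s w) :
      ∃ Z ∈ L0, v ∈ Z ∧ w ∈ Z := by
    obtain ⟨Y, hY, hv, hw⟩ := (hs v w).1 (Quotient.exact hvw)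
    obtain ⟨Z, hZ, hYZ⟩ := href Y hY
    exact ⟨Z, hZ, hYZ hv, hYZ hw⟩
  obtain ⟨τ, τ', _, _, a, a', hτ, hr, hr', ⟨v, rfl, ha⟩, ⟨v', rfl, ha'⟩, hconf⟩ := hc
  obtain ⟨w, hwv, hw⟩ := h.exists_reachFrom hs hr
  obtain ⟨w', hwv', hw'⟩ := h.exists_reachFrom hs hr'
  obtain ⟨Z, hZ, hwZ, hvZ⟩ := common_block hwv
  obtain ⟨Z', hZ', hwZ', hvZ'⟩ := common_block hwv'
  obtain ⟨b, hb, b', hb', hbc⟩ :=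
    hadm Z hZ Z' hZ' ⟨v, hvZ, v', hvZ', a, ha, a', ha', hconf⟩ w hwZ w' hwZ'
  exact ⟨τ, τ', w, w', b, b', hτ, hw, hw', hb, hb', hbc⟩

/-- **Forward/Backward Partition Correctness (two-stage grouping).** First
group `N` by the equivalence relation induced by a backward-stable partition
`Lb` refining a backward-admissible partition `L0`; then group the result by
the equivalence relation induced by a forward-stable partition `M` whose
member containing the new start vertex is a singleton. The final grouped NFA
has a conflict iff `N` has a conflict. -/
theorem fwd_bwd_partition_correctness (N : NFAA V A T)
    (L0 Lb : Set (Set V)) (hpart0 : IsPartitionOf L0)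
    (hadm : N.BwdAdmissible L0) (hpartb : IsPartitionOf Lb)
    (hrefb : RefinesPartition Lb L0) (hstableb : N.BwdStable Lb)
    (sb : Setoid V)
    (hsb : ∀ v w : V, sb.r v w ↔ ∃ Y ∈ Lb, v ∈ Y ∧ w ∈ Y)
    (M : Set (Set (Quotient sb))) (hpartM : IsPartitionOf M)
    (hstartM : ∀ Z ∈ M, (N.group sb).start ∈ Z → Z = {(N.group sb).start})
    (hstableM : (N.group sb).FwdStable M)
    (sf : Setoid (Quotient sb))
    (hsf : ∀ c d : Quotient sb, sf.r c d ↔ ∃ Z ∈ M, c ∈ Z ∧ d ∈ Z) :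
    ((N.group sb).group sf).HasConflict ↔ N.HasConflict := by
  exact ⟨fun hc => hstableb.hasConflict_of_group hadm hrefb hsb
      (hstableM.hasConflict_of_group hsf hstartM hc),
    fun hc => (hc.group sb).group sf⟩
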